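/- Let I^(∅,2), I^(11,∅), I^(∅,11), I^(2,∅) be the two-sided ideals of the cyclotomic Hecke algebra H_n(1,0) over ℂ(q) generated respectively by y_(∅,2), y_(11,∅), y_(∅,11), y_(2,∅). Then there are ℂ(q)-algebra isomorphisms H_n(1,0)/I^(∅,2) ≅ H_n(1,0)/I^(11,∅) and H_n(1,0)/I^(∅,11) ≅ H_n(1,0)/I^(2,∅), both induced by the automorphism α of H_n(1,0) with α(X) = 1 − X and α(T_i) = q − 1 − T_i. -/

import Mathlib

noncomputable section

/-- The relations of the cyclotomic Hecke algebra `H_n(1,0)` on generators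
`X, T_1, …, T_{n-1}`, indexed by `Fin n` with `0 ↦ X` and `i ↦ T_i` for `1 ≤ i ≤ n-1`. -/
inductive CycloRel (K : Type) [Field K] (q : K) (n : ℕ) :
    FreeAlgebra K (Fin n) → FreeAlgebra K (Fin n) → Prop
  | quad (i : Fin n) (hi : 1 ≤ i.val) :
      CycloRel K q n (FreeAlgebra.ι K i * FreeAlgebra.ι K i)
        ((q - 1) • FreeAlgebra.ι K i + q • (1 : FreeAlgebra K (Fin n)))
  | braid (i j : Fin n) (hi : 1 ≤ i.val) (hij : i.val + 1 = j.val) :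
      CycloRel K q n (FreeAlgebra.ι K i * FreeAlgebra.ι K j * FreeAlgebra.ι K i)
        (FreeAlgebra.ι K j * FreeAlgebra.ι K i * FreeAlgebra.ι K j)
  | comm (i j : Fin n) (hi : 1 ≤ i.val) (hj : 1 ≤ j.val)
      (hij : i.val + 2 ≤ j.val ∨ j.val + 2 ≤ i.val) :
      CycloRel K q n (FreeAlgebra.ι K i * FreeAlgebra.ι K j)
        (FreeAlgebra.ι K j * FreeAlgebra.ι K i)
  | Xcomm (x i : Fin n) (hx : x.val = 0) (hi : 2 ≤ i.val) :
      CycloRel K q n (FreeAlgebra.ι K x * FreeAlgebra.ι K i)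
        (FreeAlgebra.ι K i * FreeAlgebra.ι K x)
  | Xbraid (x t : Fin n) (hx : x.val = 0) (ht : t.val = 1) :
      CycloRel K q n
        (FreeAlgebra.ι K x * FreeAlgebra.ι K t * FreeAlgebra.ι K x * FreeAlgebra.ι K t)
        (FreeAlgebra.ι K t * FreeAlgebra.ι K x * FreeAlgebra.ι K t * FreeAlgebra.ι K x)
  | Xidem (x : Fin n) (hx : x.val = 0) :
      CycloRel K q n (FreeAlgebra.ι K x * FreeAlgebra.ι K x) (FreeAlgebra.ι K x)

/-- The cyclotomic Hecke algebra `H_n(1,0)` over `K`. -/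
abbrev CycloHecke (K : Type) [Field K] (q : K) (n : ℕ) : Type := RingQuot (CycloRel K q n)

/-- The generators of `H_n(1,0)`: `gen 0 = X`, `gen i = T_i` for `i ≥ 1`. -/
def CycloHecke.gen {K : Type} [Field K] {q : K} {n : ℕ} (i : Fin n) : CycloHecke K q n :=
  RingQuot.mkAlgHom K (CycloRel K q n) (FreeAlgebra.ι K i)

section Y

local notation "K" => RatFunc ℂ
local notation "q" => (RatFunc.X : RatFunc ℂ)

variable (n : ℕ) (hn : 1 < n)

/-- The generator `X` of `H_n(1,0)` (for `n ≥ 2`). -/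
def Xg : CycloHecke K q n := CycloHecke.gen ⟨0, by omega⟩

/-- The generator `T_1` of `H_n(1,0)` (for `n ≥ 2`). -/
def T1g : CycloHecke K q n := CycloHecke.gen ⟨1, hn⟩

/-- The element `y_(2,∅)` of `H_n(1,0)`. -/
def yTwoEmpty : CycloHecke K q n :=
  (q⁻¹ * (q + 1)⁻¹) • (T1g n hn * Xg n hn * T1g n hn * Xg n hn + Xg n hn * T1g n hn * Xg n hn)

/-- The element `y_(11,∅)` of `H_n(1,0)`. -/
def yElevenEmpty : CycloHecke K q n :=
  (q + 1)⁻¹ • (T1g n hn * Xg n hn * T1g n hn * Xg n hn -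
    q • (Xg n hn * T1g n hn * Xg n hn))

/-- The element `y_(∅,2)` of `H_n(1,0)`. -/
def yEmptyTwo : CycloHecke K q n :=
  (q + 1)⁻¹ • (1 - Xg n hn + T1g n hn - Xg n hn * T1g n hn - T1g n hn * Xg n hn +
    Xg n hn * T1g n hn * Xg n hn - T1g n hn * Xg n hn * T1g n hn +
    Xg n hn * T1g n hn * Xg n hn * T1g n hn)

/-- The element `y_(∅,11)` of `H_n(1,0)`. -/
def yEmptyEleven : CycloHecke K q n :=
  (q + 1)⁻¹ • (q • (1 : CycloHecke K q n) - q • Xg n hn - T1g n hn +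
    Xg n hn * T1g n hn + T1g n hn * Xg n hn - Xg n hn * T1g n hn * Xg n hn -
    q⁻¹ • (T1g n hn * Xg n hn * T1g n hn) +
    q⁻¹ • (Xg n hn * T1g n hn * Xg n hn * T1g n hn))

end Y


section Reflect

variable {K A : Type*} [Field K] [Ring A] [Algebra K A] {q : K} {X T S : A}

theorem quadratic_reflect (hT : T * T = (q - 1) • T + q • (1 : A)) :
    ((q - 1) • (1 : A) - T) * ((q - 1) • (1 : A) - T) =
      (q - 1) • ((q - 1) • (1 : A) - T) + q • (1 : A) := by
  simp only [mul_sub, sub_mul, smul_mul_assoc, mul_smul_comm, one_mul, mul_one, hT]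
  module

theorem braid_reflect (hT : T * T = (q - 1) • T + q • (1 : A))
    (hS : S * S = (q - 1) • S + q • (1 : A)) (hTS : T * S * T = S * T * S) :
    ((q - 1) • (1 : A) - T) * ((q - 1) • (1 : A) - S) * ((q - 1) • (1 : A) - T) =
      ((q - 1) • (1 : A) - S) * ((q - 1) • (1 : A) - T) * ((q - 1) • (1 : A) - S) := by
  simp only [mul_sub, sub_mul, smul_mul_assoc, mul_smul_comm, one_mul, mul_one, hT, hS, hTS]
  module

theorem Xbraid_reflect (hX : X * X = X) (hT : T * T = (q - 1) • T + q • (1 : A))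
    (hXT : X * T * X * T = T * X * T * X) :
    (1 - X) * ((q - 1) • (1 : A) - T) * (1 - X) * ((q - 1) • (1 : A) - T) =
      ((q - 1) • (1 : A) - T) * (1 - X) * ((q - 1) • (1 : A) - T) * (1 - X) := by
  have hXZ (Z : A) : Z * X * X = Z * X := by rw [mul_assoc, hX]
  have hTZ (Z : A) : Z * T * T = (q - 1) • (Z * T) + q • Z := by
    rw [mul_assoc, hT, mul_add, mul_smul_comm, mul_smul_comm, mul_one]
  simp only [mul_sub, sub_mul, add_mul, smul_mul_assoc, mul_smul_comm, one_mul, mul_one, hX, hT,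
    hXZ, hTZ, hXT]
  module

theorem emptyTwo_reflect (hX : X * X = X) (hT : T * T = (q - 1) • T + q • (1 : A))
    (hXT : X * T * X * T = T * X * T * X) :
    1 - (1 - X) + ((q - 1) • (1 : A) - T) - (1 - X) * ((q - 1) • (1 : A) - T) -
        ((q - 1) • (1 : A) - T) * (1 - X) + (1 - X) * ((q - 1) • (1 : A) - T) * (1 - X) -
        ((q - 1) • (1 : A) - T) * (1 - X) * ((q - 1) • (1 : A) - T) +
        (1 - X) * ((q - 1) • (1 : A) - T) * (1 - X) * ((q - 1) • (1 : A) - T) =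
      T * X * T * X - q • (X * T * X) := by
  have hTZ (Z : A) : Z * T * T = (q - 1) • (Z * T) + q • Z := by
    rw [mul_assoc, hT, mul_add, mul_smul_comm, mul_smul_comm, mul_one]
  simp only [mul_sub, sub_mul, smul_mul_assoc, mul_smul_comm, one_mul, mul_one, hX, hT,
    hTZ, hXT]
  module

theorem emptyEleven_reflect (hq : q ≠ 0) (hX : X * X = X)
    (hT : T * T = (q - 1) • T + q • (1 : A)) (hXT : X * T * X * T = T * X * T * X) :
    q • (1 : A) - q • (1 - X) - ((q - 1) • (1 : A) - T) + (1 - X) * ((q - 1) • (1 : A) - T) +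
        ((q - 1) • (1 : A) - T) * (1 - X) - (1 - X) * ((q - 1) • (1 : A) - T) * (1 - X) -
        q⁻¹ • (((q - 1) • (1 : A) - T) * (1 - X) * ((q - 1) • (1 : A) - T)) +
        q⁻¹ • ((1 - X) * ((q - 1) • (1 : A) - T) * (1 - X) * ((q - 1) • (1 : A) - T)) =
      q⁻¹ • (T * X * T * X + X * T * X) := by
  have hTZ (Z : A) : Z * T * T = (q - 1) • (Z * T) + q • Z := by
    rw [mul_assoc, hT, mul_add, mul_smul_comm, mul_smul_comm, mul_one]
  simp only [mul_sub, sub_mul, smul_mul_assoc, mul_smul_comm, one_mul, mul_one, hX, hT,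
    hTZ, hXT]
  match_scalars <;> field_simp <;> ring

end Reflect

namespace CycloHecke

section Relations

variable {K : Type} [Field K] {q : K} {n : ℕ}

theorem gen_mul_self (i : Fin n) (hi : 1 ≤ i.val) :
    (gen i : CycloHecke K q n) * gen i = (q - 1) • gen i + q • 1 := by
  simpa [gen] using RingQuot.mkAlgHom_rel K (CycloRel.quad (K := K) (q := q) i hi)

theorem gen_braid (i j : Fin n) (hi : 1 ≤ i.val) (hij : i.val + 1 = j.val) :
    (gen i : CycloHecke K q n) * gen j * gen i = gen j * gen i * gen j := by
  simpa [gen] using RingQuot.mkAlgHom_rel K (CycloRel.braid (K := K) (q := q) i j hi hij)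

theorem gen_comm (i j : Fin n) (hi : 1 ≤ i.val) (hj : 1 ≤ j.val)
    (hij : i.val + 2 ≤ j.val ∨ j.val + 2 ≤ i.val) :
    Commute (gen i : CycloHecke K q n) (gen j) := by
  simpa [gen, commute_iff_eq] using RingQuot.mkAlgHom_rel K (CycloRel.comm (K := K) (q := q) i j hi hj hij)

theorem gen_zero_comm (x i : Fin n) (hx : x.val = 0) (hi : 2 ≤ i.val) :
    Commute (gen x : CycloHecke K q n) (gen i) := by
  simpa [gen, commute_iff_eq] using
    RingQuot.mkAlgHom_rel K (CycloRel.Xcomm (K := K) (q := q) x i hx hi)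

theorem gen_zero_gen_one_braid (x t : Fin n) (hx : x.val = 0) (ht : t.val = 1) :
    (gen x : CycloHecke K q n) * gen t * gen x * gen t = gen t * gen x * gen t * gen x := by
  simpa [gen] using RingQuot.mkAlgHom_rel K (CycloRel.Xbraid (K := K) (q := q) x t hx ht)

theorem gen_zero_mul_self (x : Fin n) (hx : x.val = 0) :
    (gen x : CycloHecke K q n) * gen x = gen x := by
  simpa [gen] using RingQuot.mkAlgHom_rel K (CycloRel.Xidem (K := K) (q := q) x hx)

theorem algHom_ext {B : Type*} [Semiring B] [Algebra K B] {f g : CycloHecke K q n →ₐ[K] B}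
    (h : ∀ i, f (gen i) = g (gen i)) : f = g := by
  apply RingQuot.ringQuot_ext'
  ext i
  exact h i

end Relations

variable {K : Type} [Field K] (q : K) (n : ℕ)

/-- The image of a generator under the involution `X ↦ 1 - X`, `T_i ↦ q - 1 - T_i`. -/
def reflectedGen (i : Fin n) : CycloHecke K q n :=
  if i.val = 0 then 1 - gen i else (q - 1) • 1 - gen i

variable {q n} in
theorem reflectedGen_zero (i : Fin n) (hi : i.val = 0) :
    reflectedGen q n i = 1 - gen i := if_pos hi

variable {q n} in
theorem reflectedGen_pos (i : Fin n) (hi : 1 ≤ i.val) :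
    reflectedGen q n i = (q - 1) • 1 - gen i := if_neg (by omega)

/-- The endomorphism of `H_n(1,0)` with `X ↦ 1 - X`, `T_i ↦ q - 1 - T_i`. -/
def involutionHom : CycloHecke K q n →ₐ[K] CycloHecke K q n :=
  RingQuot.liftAlgHom K ⟨FreeAlgebra.lift K (reflectedGen q n), by
    have commute_scalar (a : CycloHecke K q n) (c : K) : Commute a (c • 1) :=
      (Commute.one_right a).smul_right c
    intro a b h
    induction h with
    | quad i hi =>
      simpa [reflectedGen_pos _ hi] using quadratic_reflect (gen_mul_self i hi)
    | braid i j hi hij =>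
      have hj : 1 ≤ j.val := by omega
      simpa [reflectedGen_pos _ hi, reflectedGen_pos _ hj] using
        braid_reflect (gen_mul_self i hi) (gen_mul_self j hj) (gen_braid i j hi hij)
    | comm i j hi hj hij =>
      simp only [map_mul, FreeAlgebra.lift_ι_apply, reflectedGen_pos _ hi, reflectedGen_pos _ hj]
      exact (commute_scalar _ _).sub_right
        ((commute_scalar _ _).symm.sub_left (gen_comm i j hi hj hij))
    | Xcomm x i hx hi =>
      simp only [map_mul, FreeAlgebra.lift_ι_apply, reflectedGen_zero _ hx,
        reflectedGen_pos i (by omega)]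
      exact (commute_scalar _ _).sub_right
        ((Commute.one_left _).sub_left (gen_zero_comm x i hx hi))
    | Xbraid x t hx ht =>
      simpa [reflectedGen_zero _ hx, reflectedGen_pos t ht.ge] using
        Xbraid_reflect (gen_zero_mul_self x hx) (gen_mul_self t ht.ge)
          (gen_zero_gen_one_braid x t hx ht)
    | Xidem x hx =>
      simp [reflectedGen_zero _ hx, mul_sub, sub_mul, gen_zero_mul_self x hx]⟩

variable {q n} in
theorem involutionHom_gen (i : Fin n) : involutionHom q n (gen i) = reflectedGen q n i := by
  simp [involutionHom, gen]

theorem involutionHom_comp_self : (involutionHom q n).comp (involutionHom q n) = .id K _ := by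
  refine algHom_ext fun i => ?_
  rcases Nat.eq_zero_or_pos i.val with hi | hi
  · simp [involutionHom_gen, reflectedGen_zero i hi]
  · simp [involutionHom_gen, reflectedGen_pos i hi]

/-- The involutive automorphism of `H_n(1,0)` with `X ↦ 1 - X`, `T_i ↦ q - 1 - T_i`. -/
def involution : CycloHecke K q n ≃ₐ[K] CycloHecke K q n :=
  .ofAlgHom (involutionHom q n) (involutionHom q n)
    (involutionHom_comp_self q n) (involutionHom_comp_self q n)

variable {q n} in
theorem involution_gen_zero (i : Fin n) (hi : i.val = 0) :
    involution q n (gen i) = 1 - gen i :=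
  (involutionHom_gen i).trans (reflectedGen_zero i hi)

variable {q n} in
theorem involution_gen (i : Fin n) (hi : 1 ≤ i.val) :
    involution q n (gen i) = (q - 1) • 1 - gen i :=
  (involutionHom_gen i).trans (reflectedGen_pos i hi)

end CycloHecke

/-- An algebra isomorphism taking `y` to `z` descends to the quotients by `y = 0` and `z = 0`. -/
theorem RingQuot.exists_algEquiv_of_map_eq {R A B : Type*} [CommSemiring R] [Semiring A]
    [Semiring B] [Algebra R A] [Algebra R B] (e : A ≃ₐ[R] B) {y : A} {z : B} (h : e y = z) :
    ∃ φ : RingQuot (fun a b : A => a = y ∧ b = 0) ≃ₐ[R] RingQuot (fun a b : B => a = z ∧ b = 0),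
      ∀ a, φ (RingQuot.mkAlgHom R _ a) = RingQuot.mkAlgHom R _ (e a) := by
  let f : RingQuot (fun a b : A => a = y ∧ b = 0) →ₐ[R]
      RingQuot (fun a b : B => a = z ∧ b = 0) :=
    RingQuot.liftAlgHom R ⟨(RingQuot.mkAlgHom R _).comp e.toAlgHom, by
      rintro _ _ ⟨rfl, rfl⟩
      exact RingQuot.mkAlgHom_rel R ⟨h, map_zero e⟩⟩
  let g : RingQuot (fun a b : B => a = z ∧ b = 0) →ₐ[R]
      RingQuot (fun a b : A => a = y ∧ b = 0) :=
    RingQuot.liftAlgHom R ⟨(RingQuot.mkAlgHom R _).comp e.symm.toAlgHom, by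
      rintro _ _ ⟨rfl, rfl⟩
      exact RingQuot.mkAlgHom_rel R ⟨e.symm_apply_eq.2 h.symm, map_zero e.symm⟩⟩
  have hf (a : A) : f (RingQuot.mkAlgHom R _ a) = RingQuot.mkAlgHom R _ (e a) :=
    RingQuot.liftAlgHom_mkAlgHom_apply ..
  have hg (b : B) : g (RingQuot.mkAlgHom R _ b) = RingQuot.mkAlgHom R _ (e.symm b) :=
    RingQuot.liftAlgHom_mkAlgHom_apply ..
  refine ⟨.ofAlgHom f g ?_ ?_, hf⟩ <;>
  · apply RingQuot.ringQuot_ext'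
    ext a
    simp [hf, hg]

section Stmt9

local notation "K" => RatFunc ℂ
local notation "q" => (RatFunc.X : RatFunc ℂ)

variable (n : ℕ) (hn : 1 < n)

/-- The quotient of `H_n(1,0)` by the two-sided ideal generated by an element `y`,
realized as a `RingQuot` by the relation `y = 0`. -/
abbrev CycloQuot (y : CycloHecke K q n) : Type :=
  RingQuot (fun a b : CycloHecke K q n => a = y ∧ b = 0)

/-- The quotient map `H_n(1,0) → H_n(1,0)/(y)`. -/
def cycloQuotMk (y : CycloHecke K q n) : CycloHecke K q n →ₐ[K] CycloQuot n y :=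
  RingQuot.mkAlgHom K _

/-- The automorphism `α` (with `α(X) = 1 − X`, `α(T_i) = q − 1 − T_i`)
induces `ℂ(q)`-algebra isomorphisms `H_n(1,0)/I^(∅,2) ≅ H_n(1,0)/I^(11,∅)` and
`H_n(1,0)/I^(∅,11) ≅ H_n(1,0)/I^(2,∅)`. -/
theorem cycloQuot_iso_of_involution :
    ∃ α : CycloHecke K q n ≃ₐ[K] CycloHecke K q n,
      α (Xg n hn) = 1 - Xg n hn ∧
      (∀ i : Fin n, 1 ≤ i.val →
        α (CycloHecke.gen i) = (q - 1) • (1 : CycloHecke K q n) - CycloHecke.gen i) ∧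
      (∃ φ : CycloQuot n (yEmptyTwo n hn) ≃ₐ[K] CycloQuot n (yElevenEmpty n hn),
        ∀ a : CycloHecke K q n,
          φ (cycloQuotMk n (yEmptyTwo n hn) a) = cycloQuotMk n (yElevenEmpty n hn) (α a)) ∧
      (∃ ψ : CycloQuot n (yEmptyEleven n hn) ≃ₐ[K] CycloQuot n (yTwoEmpty n hn),
        ∀ a : CycloHecke K q n,
          ψ (cycloQuotMk n (yEmptyEleven n hn) a) = cycloQuotMk n (yTwoEmpty n hn) (α a)) := by
  have hq : q ≠ 0 := RatFunc.X_ne_zero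
  have hX : Xg n hn * Xg n hn = Xg n hn := CycloHecke.gen_zero_mul_self _ rfl
  have hT : T1g n hn * T1g n hn = (q - 1) • T1g n hn + q • 1 := CycloHecke.gen_mul_self _ le_rfl
  have hXT : Xg n hn * T1g n hn * Xg n hn * T1g n hn = T1g n hn * Xg n hn * T1g n hn * Xg n hn :=
    CycloHecke.gen_zero_gen_one_braid _ _ rfl rfl
  have hαX : CycloHecke.involution q n (Xg n hn) = 1 - Xg n hn :=
    CycloHecke.involution_gen_zero _ rfl
  have hαT : CycloHecke.involution q n (T1g n hn) = (q - 1) • 1 - T1g n hn :=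
    CycloHecke.involution_gen _ le_rfl
  refine ⟨CycloHecke.involution q n, hαX, CycloHecke.involution_gen,
    RingQuot.exists_algEquiv_of_map_eq _ ?_, RingQuot.exists_algEquiv_of_map_eq _ ?_⟩
  · simp only [yEmptyTwo, yElevenEmpty, map_smul, map_sub, map_add, map_mul, map_one, hαX, hαT]
    rw [emptyTwo_reflect hX hT hXT]
  · simp only [yEmptyEleven, yTwoEmpty, map_smul, map_sub, map_add, map_mul, map_one, hαX, hαT]
    rw [emptyEleven_reflect hq hX hT hXT, smul_smul, mul_comm]

end Stmt9
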